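/- With f₀ as in the context: f₀ is C^∞ on [w₂,∞)×T³, |f₀(x)| ≤ 1 for all x, and there exist constants c > 0 and C₀ > 0 depending only on the choice of ζ such that for every integer k ≥ 2 and every x = (w,y) with w_k ≤ w ≤ w_{k+1}: |∂f₀/∂w (x)| ≤ c/√k, |∇_y f₀(x)| ≤ |a_{k+1}| = √(4k+5), and |∇f₀(x)| ≤ C₀·√k, where ∇f₀ is the full gradient in the variables (w,y). -/

import Mathlib

open Real MeasureTheory

noncomputable section

/-- `w_k = (27/8)·k^{3/2}`. -/
def wseq (k : ℕ) : ℝ := (27 / 8) * (k : ℝ) ^ ((3 : ℝ) / 2)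

/-- The properties of the fixed cutoff function `ζ`: smooth, `ζ = 0` on `(-∞,0]`,
`ζ = 1` on `[1,∞)`, `0 ≤ ζ ≤ 1`, `ζ' > 0` on `(0,1)`, and `ζ(t) + ζ(1-t) = 1`. -/
def IsCutoff (ζ : ℝ → ℝ) : Prop :=
  ContDiff ℝ (⊤ : ℕ∞) ζ ∧ (∀ t : ℝ, t ≤ 0 → ζ t = 0) ∧ (∀ t : ℝ, 1 ≤ t → ζ t = 1) ∧
    (∀ t : ℝ, ζ t ∈ Set.Icc (0 : ℝ) 1) ∧ (∀ t ∈ Set.Ioo (0 : ℝ) 1, 0 < deriv ζ t) ∧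
    (∀ t : ℝ, ζ t + ζ (1 - t) = 1)

/-- The properties of the fixed sequence `(a_k)` in `ℤ³`:
`|a_k|² = 4k+1` and `|a_k · a_{k+1}| ≤ |a_k||a_{k+1}|/√3` for all `k ≥ 1`. -/
def IsGoodSeq (a : ℕ → Fin 3 → ℤ) : Prop :=
  ∀ k : ℕ, 1 ≤ k →
    ((∑ i : Fin 3, (a k i) ^ 2 = 4 * (k : ℤ) + 1) ∧
      |∑ i : Fin 3, ((a k i : ℝ) * (a (k + 1) i : ℝ))| ≤
        Real.sqrt (∑ i : Fin 3, (a k i : ℝ) ^ 2) *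
          Real.sqrt (∑ i : Fin 3, (a (k + 1) i : ℝ) ^ 2) / Real.sqrt 3)

/-- The function `f₀(w,y) = Σ_{k≥2} ζ((w-w_{k-1})/(w_k-w_{k-1}))·ζ((w_{k+1}-w)/(w_{k+1}-w_k))·cos(a_k·y)`
(a locally finite sum), `2π`-periodic in each coordinate of `y`. -/
def f0 (ζ : ℝ → ℝ) (a : ℕ → Fin 3 → ℤ) (w : ℝ) (y : Fin 3 → ℝ) : ℝ :=
  ∑' k : ℕ, if 2 ≤ k then
      ζ ((w - wseq (k - 1)) / (wseq k - wseq (k - 1))) *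
        ζ ((wseq (k + 1) - w) / (wseq (k + 1) - wseq k)) *
        Real.cos (∑ i : Fin 3, (a k i : ℝ) * y i)
    else 0

/-- `h = (2e)^{-10}`. -/
def hSmall : ℝ := 1 / (2 * Real.exp 1) ^ 10

/-- `Ω = {(w,y) : w ≥ w₂, |f₀(w,y)| < 2h}`, viewed as the (2π-periodic in `y`)
subset of `ℝ × ℝ³` corresponding to a subset of `ℝ × T³`. -/
def OmegaSet (ζ : ℝ → ℝ) (a : ℕ → Fin 3 → ℤ) : Set (ℝ × (Fin 3 → ℝ)) :=
  {p | wseq 2 ≤ p.1 ∧ |f0 ζ a p.1 p.2| < 2 * hSmall}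

end

noncomputable section
open Real

theorem wseq_strictMono : StrictMono wseq := by
  intro m n hmn
  have h : (m : ℝ) < n := by exact_mod_cast hmn
  have := Real.rpow_lt_rpow (Nat.cast_nonneg m) h (by norm_num : (0 : ℝ) < 3 / 2)
  unfold wseq
  linarith

theorem wseq_eq (k : ℕ) : wseq k = 27 / 8 * (k * Real.sqrt k) := by
  unfold wseq
  rw [show (3 : ℝ) / 2 = 1 + 1 / 2 by norm_num,
    Real.rpow_add_of_nonneg (Nat.cast_nonneg k) (by norm_num) (by norm_num),
    Real.rpow_one, ← Real.sqrt_eq_rpow]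

theorem sqrt_le_wseq_succ_sub (k : ℕ) : Real.sqrt k ≤ wseq (k + 1) - wseq k := by
  rw [wseq_eq, wseq_eq]
  have h : Real.sqrt k ≤ Real.sqrt ((k + 1 : ℕ) : ℝ) :=
    Real.sqrt_le_sqrt (by push_cast; linarith)
  have h0 := Real.sqrt_nonneg (k : ℝ)
  have hk : (0 : ℝ) ≤ ((k + 1 : ℕ) : ℝ) := Nat.cast_nonneg _
  have := mul_le_mul_of_nonneg_left h hk
  push_cast at this ⊢
  nlinarith

theorem self_le_wseq (k : ℕ) : (k : ℝ) ≤ wseq k := by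
  rw [wseq_eq]
  rcases Nat.eq_zero_or_pos k with rfl | hk
  · simp
  · have h1 : (1 : ℝ) ≤ k := by exact_mod_cast hk
    have h2 : 1 ≤ Real.sqrt k := Real.one_le_sqrt.2 h1
    nlinarith

/-- The `k`-th summand of `f0`. -/
def cutoffWave (ζ : ℝ → ℝ) (a : ℕ → Fin 3 → ℤ) (w : ℝ) (y : Fin 3 → ℝ) (k : ℕ) : ℝ :=
  if 2 ≤ k then
    ζ ((w - wseq (k - 1)) / (wseq k - wseq (k - 1))) *
      ζ ((wseq (k + 1) - w) / (wseq (k + 1) - wseq k)) *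
      Real.cos (∑ i : Fin 3, (a k i : ℝ) * y i)
  else 0

section

variable {ζ : ℝ → ℝ} {a : ℕ → Fin 3 → ℤ}

theorem f0_eq_tsum (w : ℝ) (y : Fin 3 → ℝ) : f0 ζ a w y = ∑' k, cutoffWave ζ a w y k := rfl

theorem cutoffWave_eq_zero_of_le (hζ : IsCutoff ζ) {w : ℝ} (y : Fin 3 → ℝ) {k : ℕ}
    (h : w ≤ wseq (k - 1)) : cutoffWave ζ a w y k = 0 := by
  unfold cutoffWave
  split_ifs with hk
  · have h2 : wseq (k - 1) < wseq k := wseq_strictMono (by omega)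
    rw [hζ.2.1 ((w - wseq (k - 1)) / (wseq k - wseq (k - 1)))
      (div_nonpos_of_nonpos_of_nonneg (by linarith) (by linarith))]
    simp
  · rfl

theorem cutoffWave_eq_zero_of_ge (hζ : IsCutoff ζ) {w : ℝ} (y : Fin 3 → ℝ) {k : ℕ}
    (h : wseq (k + 1) ≤ w) : cutoffWave ζ a w y k = 0 := by
  unfold cutoffWave
  split_ifs with hk
  · have h2 : wseq k < wseq (k + 1) := wseq_strictMono (by omega)
    rw [hζ.2.1 ((wseq (k + 1) - w) / (wseq (k + 1) - wseq k))
      (div_nonpos_of_nonpos_of_nonneg (by linarith) (by linarith))]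
    simp
  · rfl

theorem f0_eq_sum_range (hζ : IsCutoff ζ) {w : ℝ} (y : Fin 3 → ℝ) {n : ℕ} (h : w ≤ wseq n) :
    f0 ζ a w y = ∑ k ∈ Finset.range (n + 1), cutoffWave ζ a w y k := by
  rw [f0_eq_tsum]
  refine tsum_eq_sum fun k hk => cutoffWave_eq_zero_of_le hζ y ?_
  rw [Finset.mem_range] at hk
  exact h.trans (wseq_strictMono.monotone (by omega))

theorem f0_eq_add (hζ : IsCutoff ζ) {w : ℝ} (y : Fin 3 → ℝ) {k : ℕ}
    (h1 : wseq k ≤ w) (h2 : w ≤ wseq (k + 1)) :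
    f0 ζ a w y = cutoffWave ζ a w y k + cutoffWave ζ a w y (k + 1) := by
  rw [f0_eq_tsum, tsum_eq_sum (s := {k, k + 1}), Finset.sum_pair (by omega)]
  intro j hj
  simp only [Finset.mem_insert, Finset.mem_singleton, not_or] at hj
  rcases lt_or_ge j k with hjk | hjk
  · exact cutoffWave_eq_zero_of_ge hζ y ((wseq_strictMono.monotone (by omega)).trans h1)
  · exact cutoffWave_eq_zero_of_le hζ y (h2.trans (wseq_strictMono.monotone (by omega)))

theorem cutoffWave_of_mem_Icc (hζ : IsCutoff ζ) {w : ℝ} (y : Fin 3 → ℝ) {k : ℕ} (hk : 2 ≤ k)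
    (h1 : wseq k ≤ w) :
    cutoffWave ζ a w y k = (1 - ζ ((w - wseq k) / (wseq (k + 1) - wseq k))) *
      Real.cos (∑ i, (a k i : ℝ) * y i) := by
  have hd : wseq (k - 1) < wseq k := wseq_strictMono (by omega)
  have hd' : wseq k < wseq (k + 1) := wseq_strictMono (by omega)
  have hsym := hζ.2.2.2.2.2 ((w - wseq k) / (wseq (k + 1) - wseq k))
  have harg : 1 - (w - wseq k) / (wseq (k + 1) - wseq k)
      = (wseq (k + 1) - w) / (wseq (k + 1) - wseq k) := by
    have : wseq (k + 1) - wseq k ≠ 0 := by linarith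
    field_simp
    ring
  rw [harg] at hsym
  rw [cutoffWave, if_pos hk, hζ.2.2.1 ((w - wseq (k - 1)) / (wseq k - wseq (k - 1)))
    ((one_le_div (by linarith)).2 (by linarith)), one_mul, eq_sub_of_add_eq' hsym]

theorem cutoffWave_succ_of_mem_Icc (hζ : IsCutoff ζ) {w : ℝ} (y : Fin 3 → ℝ) {k : ℕ} (hk : 1 ≤ k)
    (h2 : w ≤ wseq (k + 1)) :
    cutoffWave ζ a w y (k + 1) = ζ ((w - wseq k) / (wseq (k + 1) - wseq k)) *
      Real.cos (∑ i, (a (k + 1) i : ℝ) * y i) := by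
  have hd : wseq (k + 1) < wseq (k + 1 + 1) := wseq_strictMono (by omega)
  rw [cutoffWave, if_pos (by omega), hζ.2.2.1 ((wseq (k + 1 + 1) - w) / _)
    ((one_le_div (by linarith)).2 (by linarith)), Nat.add_sub_cancel]
  ring

theorem f0_of_mem_Icc (hζ : IsCutoff ζ) {w : ℝ} (y : Fin 3 → ℝ) {k : ℕ} (hk : 2 ≤ k)
    (h1 : wseq k ≤ w) (h2 : w ≤ wseq (k + 1)) :
    f0 ζ a w y = (1 - ζ ((w - wseq k) / (wseq (k + 1) - wseq k))) *
        Real.cos (∑ i, (a k i : ℝ) * y i) +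
      ζ ((w - wseq k) / (wseq (k + 1) - wseq k)) * Real.cos (∑ i, (a (k + 1) i : ℝ) * y i) := by
  rw [f0_eq_add hζ y h1 h2, cutoffWave_of_mem_Icc hζ y hk h1,
    cutoffWave_succ_of_mem_Icc hζ y (by omega) h2]

theorem exists_wseq_le_le {w : ℝ} (h : wseq 1 ≤ w) :
    ∃ k, 1 ≤ k ∧ wseq k ≤ w ∧ w ≤ wseq (k + 1) := by
  have hex : ∃ n, w < wseq n := by
    obtain ⟨n, hn⟩ := exists_nat_gt w
    exact ⟨n, hn.trans_le (self_le_wseq n)⟩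
  classical
  have hf := Nat.find_spec hex
  have hlt : 1 < Nat.find hex := wseq_strictMono.lt_iff_lt.1 (h.trans_lt hf)
  refine ⟨Nat.find hex - 1, by omega, not_lt.1 (Nat.find_min hex (by omega)), ?_⟩
  rw [Nat.sub_add_cancel hlt.le]
  exact hf.le

theorem abs_f0_le_one (hζ : IsCutoff ζ) (w : ℝ) (y : Fin 3 → ℝ) : |f0 ζ a w y| ≤ 1 := by
  rcases le_total w (wseq 1) with h | h
  · rw [f0_eq_sum_range hζ y h]
    simp [cutoffWave, Finset.sum_range_succ]
  · obtain ⟨k, hk, h1, h2⟩ := exists_wseq_le_le h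
    obtain ⟨hz0, hz1⟩ := hζ.2.2.2.1 ((w - wseq k) / (wseq (k + 1) - wseq k))
    have hA : |cutoffWave ζ a w y k| ≤ 1 - ζ ((w - wseq k) / (wseq (k + 1) - wseq k)) := by
      by_cases hk2 : 2 ≤ k
      · rw [cutoffWave_of_mem_Icc hζ y hk2 h1, abs_mul, abs_of_nonneg (sub_nonneg.2 hz1)]
        exact mul_le_of_le_one_right (sub_nonneg.2 hz1) (Real.abs_cos_le_one _)
      · rw [cutoffWave, if_neg hk2, abs_zero]
        exact sub_nonneg.2 hz1
    have hB : |cutoffWave ζ a w y (k + 1)| ≤ ζ ((w - wseq k) / (wseq (k + 1) - wseq k)) := by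
      rw [cutoffWave_succ_of_mem_Icc hζ y hk h2, abs_mul, abs_of_nonneg hz0]
      exact mul_le_of_le_one_right hz0 (Real.abs_cos_le_one _)
    rw [f0_eq_add hζ y h1 h2]
    exact (abs_add_le _ _).trans (by linarith)

theorem contDiff_cutoffWave (hζ : IsCutoff ζ) (k : ℕ) :
    ContDiff ℝ (⊤ : ℕ∞) (fun p : ℝ × (Fin 3 → ℝ) => cutoffWave ζ a p.1 p.2 k) := by
  have hz := hζ.1
  unfold cutoffWave
  split_ifs with hk
  · fun_prop
  · exact contDiff_const

theorem contDiff_f0 (hζ : IsCutoff ζ) :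
    ContDiff ℝ (⊤ : ℕ∞) (fun p : ℝ × (Fin 3 → ℝ) => f0 ζ a p.1 p.2) := by
  rw [contDiff_iff_contDiffAt]
  intro p
  obtain ⟨n, hn⟩ := exists_nat_gt p.1
  have hp : p.1 < wseq n := hn.trans_le (self_le_wseq n)
  have hsum : ContDiff ℝ (⊤ : ℕ∞) (fun q : ℝ × (Fin 3 → ℝ) =>
      ∑ k ∈ Finset.range (n + 1), cutoffWave ζ a q.1 q.2 k) :=
    ContDiff.sum fun k _ => contDiff_cutoffWave hζ k
  refine hsum.contDiffAt.congr_of_eventuallyEq ?_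
  filter_upwards [(isOpen_lt continuous_fst continuous_const).mem_nhds hp] with q hq
  exact f0_eq_sum_range hζ q.2 (le_of_lt hq)

theorem deriv_f0_fst (hζ : IsCutoff ζ) {w : ℝ} (y : Fin 3 → ℝ) {k : ℕ} (hk : 2 ≤ k)
    (h1 : wseq k ≤ w) (h2 : w ≤ wseq (k + 1)) :
    deriv (fun t => f0 ζ a t y) w =
      deriv ζ ((w - wseq k) / (wseq (k + 1) - wseq k)) / (wseq (k + 1) - wseq k) *
        (Real.cos (∑ i, (a (k + 1) i : ℝ) * y i) - Real.cos (∑ i, (a k i : ℝ) * y i)) := by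
  have hd : wseq k < wseq (k + 1) := wseq_strictMono (by omega)
  have hf : ContDiff ℝ (⊤ : ℕ∞) (fun t => f0 ζ a t y) :=
    (contDiff_f0 hζ).comp (contDiff_id.prodMk contDiff_const)
  have hfd : DifferentiableAt ℝ (fun t => f0 ζ a t y) w := hf.differentiable (by simp) w
  have hζd : HasDerivAt ζ (deriv ζ ((w - wseq k) / (wseq (k + 1) - wseq k)))
      ((w - wseq k) / (wseq (k + 1) - wseq k)) :=
    (hζ.1.differentiable (by simp) _).hasDerivAt
  have hlin : HasDerivAt (fun t => (t - wseq k) / (wseq (k + 1) - wseq k))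
      (1 / (wseq (k + 1) - wseq k)) w :=
    ((hasDerivAt_id w).sub_const _).div_const _
  have hcomp := hζd.comp w hlin
  have hF := ((hcomp.const_sub 1).mul_const (Real.cos (∑ i, (a k i : ℝ) * y i))).add
    (hcomp.mul_const (Real.cos (∑ i, (a (k + 1) i : ℝ) * y i)))
  have hF' := hF.hasDerivWithinAt (s := Set.Icc (wseq k) (wseq (k + 1)))
  have hG := hF'.congr (f₁ := fun t => f0 ζ a t y)
    (fun t ht => f0_of_mem_Icc hζ y hk ht.1 ht.2) (f0_of_mem_Icc hζ y hk h1 h2)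
  have huniq : UniqueDiffWithinAt ℝ (Set.Icc (wseq k) (wseq (k + 1))) w :=
    uniqueDiffOn_Icc hd w ⟨h1, h2⟩
  rw [← hfd.derivWithin huniq, hG.derivWithin huniq]
  ring

theorem hasDerivAt_cos_sum_update (b : Fin 3 → ℝ) (y : Fin 3 → ℝ) (i : Fin 3) :
    HasDerivAt (fun t => Real.cos (∑ j, b j * Function.update y i t j))
      (-Real.sin (∑ j, b j * y j) * b i) (y i) := by
  have hlin : HasDerivAt (fun t => ∑ j, b j * Function.update y i t j) (b i) (y i) := by
    have heq : (fun t => ∑ j, b j * Function.update y i t j)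
        = fun t => b i * t + ∑ j ∈ Finset.univ.erase i, b j * y j := by
      funext t
      rw [← Finset.add_sum_erase _ _ (Finset.mem_univ i), Function.update_self]
      congr 1
      refine Finset.sum_congr rfl fun j hj => ?_
      rw [Function.update_of_ne (Finset.ne_of_mem_erase hj)]
    rw [heq]
    simpa using ((hasDerivAt_id (y i)).const_mul (b i)).add_const
      (∑ j ∈ Finset.univ.erase i, b j * y j)
  have := hlin.cos
  rwa [Function.update_eq_self] at this

theorem deriv_f0_update (hζ : IsCutoff ζ) {w : ℝ} (y : Fin 3 → ℝ) {k : ℕ} (hk : 2 ≤ k)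
    (h1 : wseq k ≤ w) (h2 : w ≤ wseq (k + 1)) (i : Fin 3) :
    deriv (fun t => f0 ζ a w (Function.update y i t)) (y i) =
      (1 - ζ ((w - wseq k) / (wseq (k + 1) - wseq k))) *
        (-Real.sin (∑ j, (a k j : ℝ) * y j) * a k i) +
      ζ ((w - wseq k) / (wseq (k + 1) - wseq k)) *
        (-Real.sin (∑ j, (a (k + 1) j : ℝ) * y j) * a (k + 1) i) := by
  simp only [f0_of_mem_Icc hζ _ hk h1 h2]
  exact (((hasDerivAt_cos_sum_update (fun j => (a k j : ℝ)) y i).const_mul _).add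
    ((hasDerivAt_cos_sum_update (fun j => (a (k + 1) j : ℝ)) y i).const_mul _)).deriv

end

theorem convexCombination_sq_le {z : ℝ} (h0 : 0 ≤ z) (h1 : z ≤ 1) (u v : ℝ) :
    ((1 - z) * u + z * v) ^ 2 ≤ (1 - z) * u ^ 2 + z * v ^ 2 := by
  nlinarith [mul_nonneg (mul_nonneg h0 (sub_nonneg.2 h1)) (sq_nonneg (u - v))]

theorem neg_sin_mul_sq_le (θ b : ℝ) : (-Real.sin θ * b) ^ 2 ≤ b ^ 2 := by
  rw [mul_pow, neg_sq]
  exact mul_le_of_le_one_left (sq_nonneg b) (Real.sin_sq_le_one θ)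

theorem IsGoodSeq.sum_sq {a : ℕ → Fin 3 → ℤ} (ha : IsGoodSeq a) {k : ℕ} (hk : 1 ≤ k) :
    ∑ i, (a k i : ℝ) ^ 2 = 4 * (k : ℝ) + 1 := by
  exact_mod_cast (ha k hk).1

theorem sum_deriv_f0_update_sq_le {ζ : ℝ → ℝ} {a : ℕ → Fin 3 → ℤ} (hζ : IsCutoff ζ)
    (ha : IsGoodSeq a) {w : ℝ} (y : Fin 3 → ℝ) {k : ℕ} (hk : 2 ≤ k)
    (h1 : wseq k ≤ w) (h2 : w ≤ wseq (k + 1)) :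
    ∑ i, (deriv (fun t => f0 ζ a w (Function.update y i t)) (y i)) ^ 2 ≤ 4 * (k : ℝ) + 5 := by
  simp only [deriv_f0_update hζ y hk h1 h2]
  obtain ⟨hz0, hz1⟩ := hζ.2.2.2.1 ((w - wseq k) / (wseq (k + 1) - wseq k))
  set z := ζ ((w - wseq k) / (wseq (k + 1) - wseq k))
  have hs := ha.sum_sq (show 1 ≤ k by omega)
  have hs' := ha.sum_sq (show 1 ≤ k + 1 by omega)
  calc _ ≤ ∑ i, ((1 - z) * (a k i : ℝ) ^ 2 + z * (a (k + 1) i : ℝ) ^ 2) := by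
        refine Finset.sum_le_sum fun i _ => (convexCombination_sq_le hz0 hz1 _ _).trans ?_
        exact add_le_add
          (mul_le_mul_of_nonneg_left (neg_sin_mul_sq_le _ _) (sub_nonneg.2 hz1))
          (mul_le_mul_of_nonneg_left (neg_sin_mul_sq_le _ _) hz0)
    _ = (1 - z) * (4 * (k : ℝ) + 1) + z * (4 * ((k + 1 : ℕ) : ℝ) + 1) := by
        rw [Finset.sum_add_distrib, ← Finset.mul_sum, ← Finset.mul_sum, hs, hs']
    _ ≤ 4 * (k : ℝ) + 5 := by
        push_cast
        nlinarith

theorem IsCutoff.exists_deriv_bound {ζ : ℝ → ℝ} (hζ : IsCutoff ζ) :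
    ∃ M : ℝ, 0 < M ∧ ∀ t ∈ Set.Icc (0 : ℝ) 1, |deriv ζ t| ≤ M := by
  have hc : Continuous (deriv ζ) := hζ.1.continuous_deriv (by simp)
  obtain ⟨M, hM⟩ := isCompact_Icc.exists_bound_of_continuousOn (s := Set.Icc (0 : ℝ) 1)
    hc.continuousOn
  exact ⟨max M 1, by positivity, fun t ht => (hM t ht).trans (le_max_left _ _)⟩

theorem abs_deriv_f0_fst_le {ζ : ℝ → ℝ} {a : ℕ → Fin 3 → ℤ} (hζ : IsCutoff ζ) {M : ℝ}
    (hM : ∀ t ∈ Set.Icc (0 : ℝ) 1, |deriv ζ t| ≤ M)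
    {w : ℝ} (y : Fin 3 → ℝ) {k : ℕ} (hk : 2 ≤ k)
    (h1 : wseq k ≤ w) (h2 : w ≤ wseq (k + 1)) :
    |deriv (fun t => f0 ζ a t y) w| ≤ 2 * M / Real.sqrt k := by
  have hk0 : (0 : ℝ) < Real.sqrt k := Real.sqrt_pos.2 (by exact_mod_cast (by omega : 0 < k))
  have hd := sqrt_le_wseq_succ_sub k
  have hd0 : 0 < wseq (k + 1) - wseq k := hk0.trans_le hd
  have hm := hM ((w - wseq k) / (wseq (k + 1) - wseq k))
    ⟨div_nonneg (by linarith) hd0.le, (div_le_one hd0).2 (by linarith)⟩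
  have hM0 : 0 ≤ M := (abs_nonneg _).trans hm
  have hcos : |Real.cos (∑ i, (a (k + 1) i : ℝ) * y i) - Real.cos (∑ i, (a k i : ℝ) * y i)|
      ≤ 2 := by
    refine (abs_sub _ _).trans ?_
    linarith [Real.abs_cos_le_one (∑ i, (a (k + 1) i : ℝ) * y i),
      Real.abs_cos_le_one (∑ i, (a k i : ℝ) * y i)]
  rw [deriv_f0_fst hζ y hk h1 h2, abs_mul, abs_div, abs_of_pos hd0]
  calc _ ≤ M / Real.sqrt k * 2 := by gcongr
    _ = 2 * M / Real.sqrt k := by ring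

/-- **Lemma 1.2.** `f₀ ∈ C^∞([w₂,∞)×T³)`, `|f₀| ≤ 1`, and there are constants `c, C₀ > 0`
depending only on `ζ` such that for `k ≥ 2` and `w_k ≤ w ≤ w_{k+1}`:
`|∂f₀/∂w| ≤ c/√k`, `|∇_y f₀| ≤ |a_{k+1}| = √(4k+5)`, and `|∇f₀| ≤ C₀√k`. -/
theorem statement5 (ζ : ℝ → ℝ) (hζ : IsCutoff ζ) :
    ∃ c : ℝ, 0 < c ∧ ∃ C₀ : ℝ, 0 < C₀ ∧
      ∀ a : ℕ → Fin 3 → ℤ, IsGoodSeq a →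
        (ContDiffOn ℝ (⊤ : ℕ∞) (fun p : ℝ × (Fin 3 → ℝ) => f0 ζ a p.1 p.2)
            {p : ℝ × (Fin 3 → ℝ) | wseq 2 ≤ p.1}) ∧
        (∀ (w : ℝ) (y : Fin 3 → ℝ), |f0 ζ a w y| ≤ 1) ∧
        (∀ k : ℕ, 2 ≤ k → ∀ (w : ℝ) (y : Fin 3 → ℝ), wseq k ≤ w → w ≤ wseq (k + 1) →
          |deriv (fun t => f0 ζ a t y) w| ≤ c / Real.sqrt k ∧
          Real.sqrt (∑ i : Fin 3,
              (deriv (fun t => f0 ζ a w (Function.update y i t)) (y i)) ^ 2) ≤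
            Real.sqrt (4 * (k : ℝ) + 5) ∧
          Real.sqrt (∑ i : Fin 3, (a (k + 1) i : ℝ) ^ 2) = Real.sqrt (4 * (k : ℝ) + 5) ∧
          Real.sqrt ((deriv (fun t => f0 ζ a t y) w) ^ 2 + ∑ i : Fin 3,
              (deriv (fun t => f0 ζ a w (Function.update y i t)) (y i)) ^ 2) ≤
            C₀ * Real.sqrt k) := by
  obtain ⟨M, hM0, hM⟩ := hζ.exists_deriv_bound
  refine ⟨2 * M, by positivity, 2 * M + 3, by positivity, fun a ha =>
    ⟨(contDiff_f0 hζ).contDiffOn, abs_f0_le_one hζ, fun k hk w y h1 h2 => ?_⟩⟩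
  have hw := abs_deriv_f0_fst_le (a := a) hζ hM y hk h1 h2
  have hy := sum_deriv_f0_update_sq_le hζ ha y hk h1 h2
  refine ⟨hw, Real.sqrt_le_sqrt hy, ?_, ?_⟩
  · rw [ha.sum_sq (by omega)]
    congr 1
    push_cast
    ring
  · have hk1 : (1 : ℝ) ≤ k := by exact_mod_cast (by omega : 1 ≤ k)
    have hsk : 1 ≤ Real.sqrt k := Real.one_le_sqrt.2 hk1
    have hw' : |deriv (fun t => f0 ζ a t y) w| ≤ 2 * M :=
      hw.trans (div_le_self (by positivity) hsk)
    have hw2 : (deriv (fun t => f0 ζ a t y) w) ^ 2 ≤ (2 * M) ^ 2 :=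
      sq_le_sq' (abs_le.1 hw').1 (abs_le.1 hw').2
    refine Real.sqrt_le_iff.2 ⟨by positivity, ?_⟩
    rw [mul_pow, Real.sq_sqrt (by positivity)]
    have h4 : (2 * M) ^ 2 ≤ (2 * M) ^ 2 * k := le_mul_of_one_le_right (by positivity) hk1
    have h5 : 0 ≤ M * k := by positivity
    nlinarith

end
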